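/- Let n = 2m+1 ≥ 7 be odd and let X be the number of bulbs on at the terminal time n of the standard lightbulb process on n bulbs. Let σ_V² = (n/4)(1 − λ̄_{n,2,𝐧}) + (n²/4)λ̄_{n,2,𝐧}, where 𝐧 = (1,…,n). Then sup over z ∈ ℝ of |P((X − n/2)/σ_V ≤ z) − P(Z ≤ z)| ≤ (n/(2σ_V²))·Δ̄₁ + 1.64·n/σ_V³ + (2/σ_V)(1 + 1/√(2π)), where Z is a standard normal random variable and Δ̄₁ = 1/√n + (1/(2√2))e^{−n/4}. -/

import Mathlib

open MeasureTheory ProbabilityTheory Finset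

/-- `λ_{n,b,s} = ∑_{t=0}^{b} C(b,t) (−2)^t (s)_t/(n)_t`. -/
noncomputable def lam (n b s : ℕ) : ℝ :=
  ∑ t ∈ Finset.range (b + 1),
    (b.choose t : ℝ) * (-2 : ℝ) ^ t * (s.descFactorial t : ℝ) / (n.descFactorial t : ℝ)

/-- `λ̄_{n,b,𝐧}` for the full pattern `𝐧 = (1,…,n)` with `n = 2m+1` odd: the two factors
`λ_{n,b,m}` and `λ_{n,b,m+1}` in the product are both replaced by their average. -/
noncomputable def lamBarFull (n b m : ℕ) : ℝ :=
  (∏ r ∈ Finset.Icc 1 n \ {m, m + 1}, lam n b r) * ((lam n b m + lam n b (m + 1)) / 2) ^ 2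

/-- The arrays of switch variables having exactly `s r` switches in stage `r`. -/
def validArrays (n k : ℕ) (s : Fin k → ℕ) : Finset (Fin k → Fin n → Bool) :=
  Finset.univ.filter (fun e => ∀ r, (Finset.univ.filter (fun j => e r j = true)).card = s r)

/-- Terminal state of bulb `j` (all bulbs initially off). -/
def bulbOn {n k : ℕ} (e : Fin k → Fin n → Bool) (j : Fin n) : Bool :=
  decide ((Finset.univ.filter (fun r => e r j = true)).card % 2 = 1)

/-- Number of bulbs on at the terminal time. -/
def numOn {n k : ℕ} (e : Fin k → Fin n → Bool) : ℕ :=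
  (Finset.univ.filter (fun j => bulbOn e j = true)).card

/-- The standard switch pattern `𝐧 = (1,…,n)`: stage `r` toggles `r+1` bulbs for `r : Fin n`. -/
def stdPattern (n : ℕ) : Fin n → ℕ := fun r => (r : ℕ) + 1

section Gaussian

/-- The standard normal density. -/
noncomputable def stdPDF (x : ℝ) : ℝ := gaussianPDFReal 0 1 x

/-- The standard normal distribution function. -/
noncomputable def stdCDF (z : ℝ) : ℝ := ((gaussianReal 0 1) (Set.Iic z)).toReal

lemma stdPDF_eq (x : ℝ) : stdPDF x = (Real.sqrt (2 * Real.pi))⁻¹ * Real.exp (-x ^ 2 / 2) := by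
  simp [stdPDF, gaussianPDFReal]

lemma stdPDF_pos (x : ℝ) : 0 < stdPDF x := gaussianPDFReal_pos 0 1 x one_ne_zero

lemma stdPDF_neg (x : ℝ) : stdPDF (-x) = stdPDF x := by simp [stdPDF_eq]

lemma hasDerivAt_stdPDF (x : ℝ) : HasDerivAt stdPDF (-x * stdPDF x) x := by
  have h : HasDerivAt (fun x : ℝ => (Real.sqrt (2 * Real.pi))⁻¹ * Real.exp (-x ^ 2 / 2))
      ((Real.sqrt (2 * Real.pi))⁻¹ * (Real.exp (-x ^ 2 / 2) * (-(2 * x) / 2))) x := by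
    have h1 : HasDerivAt (fun x : ℝ => -x ^ 2 / 2) (-(2 * x) / 2) x := by
      simpa using ((hasDerivAt_pow 2 x).neg.div_const 2)
    exact h1.exp.const_mul _
  convert h using 1
  · ext y; exact stdPDF_eq y
  · rw [stdPDF_eq]; ring

lemma continuous_stdPDF : Continuous stdPDF :=
  continuous_iff_continuousAt.2 fun x => (hasDerivAt_stdPDF x).continuousAt

lemma integrable_stdPDF : Integrable stdPDF := integrable_gaussianPDFReal 0 1

lemma stdCDF_eq_integral (z : ℝ) : stdCDF z = ∫ x in Set.Iic z, stdPDF x := by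
  rw [stdCDF, gaussianReal_apply_eq_integral 0 one_ne_zero, ENNReal.toReal_ofReal]
  · rfl
  · exact integral_nonneg fun x => gaussianPDFReal_nonneg _ _ _

lemma stdCDF_nonneg (z : ℝ) : 0 ≤ stdCDF z := ENNReal.toReal_nonneg

lemma stdCDF_le_one (z : ℝ) : stdCDF z ≤ 1 := by
  simpa [stdCDF, Measure.real] using
    (measureReal_le_one (μ := gaussianReal 0 1) (s := Set.Iic z))

lemma stdCDF_mono : Monotone stdCDF := fun _ _ hab =>
  ENNReal.toReal_mono (measure_ne_top _ _) (measure_mono (Set.Iic_subset_Iic.2 hab))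

lemma one_sub_stdCDF (z : ℝ) : 1 - stdCDF z = ∫ x in Set.Ioi z, stdPDF x := by
  have h := intervalIntegral.integral_Iic_add_Ioi (b := z) integrable_stdPDF.integrableOn
    integrable_stdPDF.integrableOn
  have h1 : ∫ x, stdPDF x = 1 := integral_gaussianPDFReal_eq_one 0 one_ne_zero
  rw [stdCDF_eq_integral]
  linarith

lemma hasDerivAt_stdCDF (x : ℝ) : HasDerivAt stdCDF (stdPDF x) x := by
  have h : ∀ z, stdCDF z = stdCDF 0 + ∫ t in (0 : ℝ)..z, stdPDF t := fun z => by
    rw [← intervalIntegral.integral_Iic_sub_Iic integrable_stdPDF.integrableOn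
      integrable_stdPDF.integrableOn, stdCDF_eq_integral z, stdCDF_eq_integral 0]
    ring
  have h2 := intervalIntegral.integral_hasDerivAt_right
    (integrable_stdPDF.intervalIntegrable (a := 0) (b := x))
    (continuous_stdPDF.stronglyMeasurableAtFilter _ _) continuous_stdPDF.continuousAt
  rw [funext h]
  exact h2.const_add _

lemma stdCDF_neg (z : ℝ) : stdCDF (-z) = 1 - stdCDF z := by
  rw [one_sub_stdCDF, stdCDF_eq_integral, ← integral_comp_neg_Ioi]
  simp [stdPDF_neg]

lemma tendsto_stdPDF_atTop : Filter.Tendsto stdPDF Filter.atTop (nhds 0) := by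
  have h : Filter.Tendsto (fun x : ℝ => -x ^ 2 / 2) Filter.atTop Filter.atBot := by
    have := (Filter.tendsto_pow_atTop (α := ℝ) two_ne_zero).const_mul_atTop
      (show (0 : ℝ) < 1 / 2 by norm_num)
    refine (Filter.tendsto_neg_atTop_atBot.comp this).congr fun x => ?_
    simp only [Function.comp]; ring
  have h2 := (Real.tendsto_exp_atBot.comp h).const_mul (Real.sqrt (2 * Real.pi))⁻¹
  rw [mul_zero] at h2
  exact h2.congr fun x => (stdPDF_eq x).symm

lemma integrable_mul_stdPDF : Integrable fun x => x * stdPDF x := by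
  refine ((integrable_mul_exp_neg_mul_sq (b := 1 / 2) (by norm_num)).const_mul
    (Real.sqrt (2 * Real.pi))⁻¹).congr (Filter.Eventually.of_forall fun x => ?_)
  simp only [stdPDF_eq]
  rw [show -(1 / 2) * x ^ 2 = -x ^ 2 / 2 by ring]
  ring

/-- Mills' inequality. -/
lemma mul_one_sub_stdCDF_le (y : ℝ) : y * (1 - stdCDF y) ≤ stdPDF y := by
  have h : ∫ x in Set.Ioi y, x * stdPDF x = stdPDF y := by
    have h1 := integral_Ioi_of_hasDerivAt_of_tendsto' (a := y) (f := fun x => -stdPDF x)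
      (f' := fun x => x * stdPDF x) (m := 0)
      (fun x _ => by simpa using (hasDerivAt_stdPDF x).fun_neg)
      integrable_mul_stdPDF.integrableOn (by simpa using tendsto_stdPDF_atTop.neg)
    simpa using h1
  rw [one_sub_stdCDF, ← integral_const_mul, ← h]
  refine setIntegral_mono_on (integrable_stdPDF.integrableOn.const_mul y)
    integrable_mul_stdPDF.integrableOn measurableSet_Ioi fun x hx => ?_
  exact mul_le_mul_of_nonneg_right (le_of_lt hx) (stdPDF_pos x).le

lemma neg_mul_stdCDF_le (y : ℝ) : -y * stdCDF y ≤ stdPDF y := by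
  have h := mul_one_sub_stdCDF_le (-y)
  rwa [stdCDF_neg, stdPDF_neg, sub_sub_cancel] at h

lemma stdPDF_le (x : ℝ) : stdPDF x ≤ 1 / Real.sqrt (2 * Real.pi) := by
  rw [stdPDF_eq, one_div]
  refine mul_le_of_le_one_right (by positivity) (Real.exp_le_one_iff.2 ?_)
  nlinarith [sq_nonneg x]

lemma stdCDF_add_le (x : ℝ) {d : ℝ} (hd : 0 ≤ d) :
    stdCDF (x + d) ≤ stdCDF x + 1 / Real.sqrt (2 * Real.pi) * d := by
  have h := image_sub_le_mul_sub_of_deriv_le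
    (fun y => (hasDerivAt_stdCDF y).differentiableAt)
    (fun y => by rw [(hasDerivAt_stdCDF y).deriv]; exact stdPDF_le y)
    (show x ≤ x + d by linarith)
  rw [add_sub_cancel_left] at h
  linarith

lemma stdCDF_mul_one_sub_le (y : ℝ) : stdCDF y * (1 - stdCDF y) ≤ 2 * stdPDF y := by
  have h0 := stdCDF_nonneg y
  have h1 := stdCDF_le_one y
  have hp := stdPDF_pos y
  rcases le_or_gt 1 y with hy | hy
  · nlinarith [mul_one_sub_stdCDF_le y, mul_nonneg (sub_nonneg.2 hy) (sub_nonneg.2 h1),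
      mul_nonneg (sub_nonneg.2 h1) (sub_nonneg.2 h1)]
  rcases le_or_gt y (-1) with hy' | hy'
  · nlinarith [neg_mul_stdCDF_le y, mul_nonneg (sub_nonneg.2 hy') h0, mul_nonneg h0 h0]
  · have h2 : 1 / 8 ≤ stdPDF y := by
      rw [stdPDF_eq]
      have hs : Real.sqrt (2 * Real.pi) ≤ 3 := by
        rw [Real.sqrt_le_left (by norm_num)]
        nlinarith [Real.pi_lt_four]
      have hs' : (1 : ℝ) / 3 ≤ (Real.sqrt (2 * Real.pi))⁻¹ := by
        rw [← one_div]
        exact one_div_le_one_div_of_le (Real.sqrt_pos.2 (by positivity)) hs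
      have he : 1 / 2 ≤ Real.exp (-y ^ 2 / 2) := by
        have := Real.add_one_le_exp (-y ^ 2 / 2)
        nlinarith
      nlinarith
    nlinarith [sq_nonneg (stdCDF y - 1 / 2)]

end Gaussian

section SteinSolution

/-- The solution of the Stein equation `f' y = y f y + 1(y ≤ z) - Φ z`. -/
noncomputable def steinSol (z w : ℝ) : ℝ :=
  stdCDF (min w z) * (1 - stdCDF (max w z)) / stdPDF w

lemma steinSol_nonneg (z w : ℝ) : 0 ≤ steinSol z w :=
  div_nonneg (mul_nonneg (stdCDF_nonneg _) (sub_nonneg.2 (stdCDF_le_one _))) (stdPDF_pos w).le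

lemma steinSol_le_two (z w : ℝ) : steinSol z w ≤ 2 := by
  rw [steinSol, div_le_iff₀ (stdPDF_pos w)]
  refine le_trans ?_ (stdCDF_mul_one_sub_le w)
  exact mul_le_mul (stdCDF_mono (min_le_left _ _))
    (sub_le_sub_left (stdCDF_mono (le_max_left _ _)) 1) (sub_nonneg.2 (stdCDF_le_one _))
    (stdCDF_nonneg _)

lemma continuous_stdCDF : Continuous stdCDF :=
  continuous_iff_continuousAt.2 fun x => (hasDerivAt_stdCDF x).continuousAt

lemma continuous_steinSol (z : ℝ) : Continuous (steinSol z) := by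
  unfold steinSol
  refine Continuous.div ?_ continuous_stdPDF fun x => (stdPDF_pos x).ne'
  exact (continuous_stdCDF.comp (by fun_prop)).mul
    (continuous_const.sub (continuous_stdCDF.comp (by fun_prop)))

lemma hasDerivAt_steinSol {z y : ℝ} (hy : y ≠ z) :
    HasDerivAt (steinSol z) (y * steinSol z y + (if y ≤ z then 1 else 0) - stdCDF z) y := by
  have hp := (stdPDF_pos y).ne'
  rcases lt_or_gt_of_ne hy with h | h
  · have h1 : HasDerivAt (fun w => stdCDF w * (1 - stdCDF z) / stdPDF w)
        (y * steinSol z y + (if y ≤ z then 1 else 0) - stdCDF z) y := by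
      refine (((hasDerivAt_stdCDF y).mul_const (1 - stdCDF z)).div
        (hasDerivAt_stdPDF y) hp).congr_deriv ?_
      rw [if_pos h.le, steinSol, min_eq_left h.le, max_eq_right h.le]
      field_simp
      ring
    refine h1.congr_of_eventuallyEq ?_
    filter_upwards [Iio_mem_nhds h] with w hw
    rw [steinSol, min_eq_left (le_of_lt hw), max_eq_right (le_of_lt hw)]
  · have h1 : HasDerivAt (fun w => stdCDF z * (1 - stdCDF w) / stdPDF w)
        (y * steinSol z y + (if y ≤ z then 1 else 0) - stdCDF z) y := by
      refine ((((hasDerivAt_stdCDF y).const_sub 1).const_mul (stdCDF z)).div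
        (hasDerivAt_stdPDF y) hp).congr_deriv ?_
      rw [if_neg h.not_ge, steinSol, min_eq_right h.le, max_eq_left h.le]
      field_simp
      ring
    refine h1.congr_of_eventuallyEq ?_
    filter_upwards [Ioi_mem_nhds h] with w hw
    rw [steinSol, min_eq_right (le_of_lt hw), max_eq_left (le_of_lt hw)]

lemma abs_mul_steinSol_add_le_one (z y : ℝ) :
    |y * steinSol z y + (if y ≤ z then 1 else 0) - stdCDF z| ≤ 1 := by
  have hp := stdPDF_pos y
  have m1 := mul_one_sub_stdCDF_le y
  have m2 := neg_mul_stdCDF_le y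
  have a0 := stdCDF_nonneg y
  have a1 := stdCDF_le_one y
  have b0 := stdCDF_nonneg z
  have b1 := stdCDF_le_one z
  rw [steinSol, abs_le]
  rcases le_or_gt y z with h | h
  · have hm := stdCDF_mono h
    rw [if_pos h, min_eq_left h, max_eq_right h]
    have u1 : y * (stdCDF y * (1 - stdCDF z) / stdPDF y) ≤ stdCDF z := by
      rw [← mul_div_assoc, div_le_iff₀ hp]
      rcases le_or_gt 0 y with hy | hy
      · calc y * (stdCDF y * (1 - stdCDF z)) = stdCDF y * (y * (1 - stdCDF z)) := by ring
          _ ≤ stdCDF z * stdPDF y := mul_le_mul hm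
              ((mul_le_mul_of_nonneg_left (by linarith) hy).trans m1)
              (mul_nonneg hy (by linarith)) b0
      · have : 0 ≤ stdCDF y * (1 - stdCDF z) := mul_nonneg a0 (by linarith)
        nlinarith [mul_nonneg b0 hp.le]
    have u2 : -(1 - stdCDF z) ≤ y * (stdCDF y * (1 - stdCDF z) / stdPDF y) := by
      rw [← mul_div_assoc, le_div_iff₀ hp]
      nlinarith
    constructor <;> linarith
  · have hm := stdCDF_mono h.le
    rw [if_neg h.not_ge, min_eq_right h.le, max_eq_left h.le]
    have u1 : y * (stdCDF z * (1 - stdCDF y) / stdPDF y) ≤ stdCDF z := by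
      rw [← mul_div_assoc, div_le_iff₀ hp]
      nlinarith
    have u2 : -(1 - stdCDF z) ≤ y * (stdCDF z * (1 - stdCDF y) / stdPDF y) := by
      rw [← mul_div_assoc, le_div_iff₀ hp]
      rcases le_or_gt y 0 with hy | hy
      · have : (1 - stdCDF y) * (-y * stdCDF z) ≤ (1 - stdCDF z) * stdPDF y :=
          mul_le_mul (by linarith)
            ((mul_le_mul_of_nonneg_left hm (by linarith)).trans m2)
            (mul_nonneg (by linarith) b0) (by linarith)
        nlinarith
      · have : 0 ≤ stdCDF z * (1 - stdCDF y) := mul_nonneg b0 (by linarith)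
        nlinarith [mul_nonneg (sub_nonneg.2 b1) hp.le]
    constructor <;> linarith

lemma sub_le_of_hasDerivAt_off_point {f f' : ℝ → ℝ} (hf : Continuous f) {z : ℝ}
    (hd : ∀ y, y ≠ z → HasDerivAt f (f' y) y) {a b C : ℝ} (hab : a ≤ b)
    (hC : ∀ y ∈ Set.Ioo a b, f' y ≤ C) : f b - f a ≤ C * (b - a) := by
  have key : ∀ a' b', a ≤ a' → a' ≤ b' → b' ≤ b → z ∉ Set.Ioo a' b' →
      f b' - f a' ≤ C * (b' - a') := by
    intro a' b' h1 h2 h3 hz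
    have hne : ∀ y ∈ Set.Ioo a' b', y ≠ z := fun y hy h => hz (h ▸ hy)
    refine (convex_Icc a' b').image_sub_le_mul_sub_of_deriv_le hf.continuousOn ?_ ?_ a'
      (Set.left_mem_Icc.2 h2) b' (Set.right_mem_Icc.2 h2) h2
    · rw [interior_Icc]
      exact fun y hy => (hd y (hne y hy)).differentiableAt.differentiableWithinAt
    · rw [interior_Icc]
      intro y hy
      rw [(hd y (hne y hy)).deriv]
      exact hC y ⟨h1.trans_lt hy.1, hy.2.trans_le h3⟩
  by_cases hz : z ∈ Set.Ioo a b
  · have h1 := key a z le_rfl hz.1.le hz.2.le (fun h => lt_irrefl _ h.2)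
    have h2 := key z b hz.1.le hz.2.le le_rfl (fun h => lt_irrefl _ h.1)
    linarith
  · exact key a b le_rfl hab le_rfl hz

lemma abs_steinSol_sub_le (z a b : ℝ) : |steinSol z b - steinSol z a| ≤ |b - a| := by
  wlog hab : a ≤ b generalizing a b
  · rw [abs_sub_comm, abs_sub_comm b]
    exact this b a (le_of_not_ge hab)
  have h1 := sub_le_of_hasDerivAt_off_point (continuous_steinSol z)
    (fun y hy => hasDerivAt_steinSol hy) hab
    (C := 1) fun y _ => (abs_le.1 (abs_mul_steinSol_add_le_one z y)).2
  have h2 := sub_le_of_hasDerivAt_off_point (continuous_steinSol z).neg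
    (fun y hy => (hasDerivAt_steinSol hy).neg) hab
    (C := 1) fun y _ => by linarith [(abs_le.1 (abs_mul_steinSol_add_le_one z y)).1]
  simp only [Pi.neg_apply] at h2
  rw [abs_of_nonneg (sub_nonneg.2 hab), abs_le]
  constructor <;> linarith

lemma abs_mul_steinSol_sub_le (z w y : ℝ) :
    |y * steinSol z y - w * steinSol z w| ≤ (|w| + 2) * |y - w| := by
  have h : y * steinSol z y - w * steinSol z w =
      w * (steinSol z y - steinSol z w) + (y - w) * steinSol z y := by ring
  rw [h]
  refine (abs_add_le _ _).trans ?_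
  rw [abs_mul, abs_mul, abs_of_nonneg (steinSol_nonneg z y), add_mul, mul_comm 2]
  exact add_le_add (mul_le_mul_of_nonneg_left (abs_steinSol_sub_le z w y) (abs_nonneg _))
    (mul_le_mul_of_nonneg_left (steinSol_le_two z y) (abs_nonneg _))

lemma steinSol_increment_le {z a d w : ℝ} (hd : 0 ≤ d) (hw : w = a ∨ w = a + d) :
    steinSol z (a + d) - steinSol z a ≤
      (w * steinSol z w + (|w| + 2) * d + (if w ≤ z + d then 1 else 0) - stdCDF z) * d := by
  have h := sub_le_of_hasDerivAt_off_point (continuous_steinSol z)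
    (fun y hy => hasDerivAt_steinSol hy) (show a ≤ a + d by linarith)
    (C := w * steinSol z w + (|w| + 2) * d + (if w ≤ z + d then 1 else 0) - stdCDF z) ?_
  · simpa using h
  · intro y hy
    have hyw : |y - w| ≤ d := by
      rw [abs_le]
      rcases hw with rfl | rfl <;> constructor <;> linarith [hy.1, hy.2]
    have h1 := (abs_le.1 (abs_mul_steinSol_sub_le z w y)).2
    have h2 : (|w| + 2) * |y - w| ≤ (|w| + 2) * d :=
      mul_le_mul_of_nonneg_left hyw (by positivity)
    have h3 : (if y ≤ z then (1 : ℝ) else 0) ≤ if w ≤ z + d then 1 else 0 := by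
      split_ifs with h4 h5 <;> norm_num
      exact h5 (by linarith [(abs_le.1 hyw).1])
    linarith

lemma le_steinSol_increment {z a d w : ℝ} (hd : 0 ≤ d) (hw : w = a ∨ w = a + d) :
    (w * steinSol z w - (|w| + 2) * d + (if w ≤ z - d then 1 else 0) - stdCDF z) * d ≤
      steinSol z (a + d) - steinSol z a := by
  have h := sub_le_of_hasDerivAt_off_point (continuous_steinSol z).neg
    (fun y hy => (hasDerivAt_steinSol hy).neg) (show a ≤ a + d by linarith)
    (C := -(w * steinSol z w - (|w| + 2) * d + (if w ≤ z - d then 1 else 0) - stdCDF z)) ?_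
  · simp only [Pi.neg_apply, add_sub_cancel_left] at h
    linarith
  · intro y hy
    have hyw : |y - w| ≤ d := by
      rw [abs_le]
      rcases hw with rfl | rfl <;> constructor <;> linarith [hy.1, hy.2]
    have h1 := (abs_le.1 (abs_mul_steinSol_sub_le z w y)).1
    have h2 : (|w| + 2) * |y - w| ≤ (|w| + 2) * d :=
      mul_le_mul_of_nonneg_left hyw (by positivity)
    have h3 : (if w ≤ z - d then (1 : ℝ) else 0) ≤ if y ≤ z then 1 else 0 := by
      split_ifs with h4 h5 <;> norm_num
      exact h5 (by linarith [(abs_le.1 hyw).2])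
    linarith

end SteinSolution

section CubeStein

/-- The number of coordinates of `x` equal to `true`. -/
def weight {n : ℕ} (x : Fin n → Bool) : ℕ := (Finset.univ.filter fun j => x j = true).card

/-- The vector `x` with coordinate `j` negated. -/
def flipAt {n : ℕ} (j : Fin n) (x : Fin n → Bool) : Fin n → Bool := Function.update x j (!x j)

lemma flipAt_involutive {n : ℕ} (j : Fin n) : Function.Involutive (flipAt j) := fun x => by
  simp [flipAt]

lemma sum_comp_flipAt {n : ℕ} (j : Fin n) (F : (Fin n → Bool) → ℝ) :
    ∑ x, F (flipAt j x) = ∑ x, F x :=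
  Equiv.sum_comp (flipAt_involutive j).toPerm F

lemma weight_eq_sum {n : ℕ} (x : Fin n → Bool) :
    (weight x : ℝ) = ∑ j, if x j = true then (1 : ℝ) else 0 := by
  rw [weight, Finset.card_filter]
  push_cast
  rfl

lemma weight_update {n : ℕ} (x : Fin n → Bool) (j : Fin n) (b : Bool) :
    (weight (Function.update x j b) : ℝ) =
      weight x + (if b = true then 1 else 0) - if x j = true then 1 else 0 := by
  rw [weight_eq_sum, weight_eq_sum, ← Finset.add_sum_erase _ _ (Finset.mem_univ j),
    ← Finset.add_sum_erase (a := j) (f := fun j => if x j = true then (1 : ℝ) else 0) _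
      (Finset.mem_univ j)]
  have h : ∀ i ∈ Finset.univ.erase j,
      (if Function.update x j b i = true then (1 : ℝ) else 0) = if x i = true then 1 else 0 :=
    fun i hi => by rw [Function.update_of_ne (Finset.ne_of_mem_erase hi)]
  rw [Finset.sum_congr rfl h, Function.update_self]
  ring

/-- The weight of `x`, centred and divided by `s`. -/
noncomputable def stdWeight {n : ℕ} (s : ℝ) (x : Fin n → Bool) : ℝ := ((weight x : ℝ) - n / 2) / s

lemma stdWeight_update_true {n : ℕ} (s : ℝ) (x : Fin n → Bool) (j : Fin n) :
    stdWeight s (Function.update x j true) = stdWeight s (Function.update x j false) + 1 / s := by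
  simp only [stdWeight, weight_update]
  simp
  ring

lemma sum_sign_mul {n : ℕ} (j : Fin n) (F : (Fin n → Bool) → ℝ) :
    ∑ x, (if x j = true then 1 else -1) * F x =
      1 / 2 * ∑ x, (F (Function.update x j true) - F (Function.update x j false)) := by
  have h := sum_comp_flipAt j fun x => (if x j = true then 1 else -1) * F x
  have h2 : ∑ x, ((if flipAt j x j = true then 1 else -1) * F (flipAt j x) +
      (if x j = true then 1 else -1) * F x) =
      ∑ x, (F (Function.update x j true) - F (Function.update x j false)) := by
    refine Finset.sum_congr rfl fun x _ => ?_
    have hx : Function.update x j (x j) = x := Function.update_eq_self j x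
    rcases hb : x j with _ | _ <;> rw [hb] at hx <;> simp [flipAt, hb, hx] <;> ring
  rw [Finset.sum_add_distrib, h] at h2
  linarith

lemma stdWeight_eq_sum {n : ℕ} (s : ℝ) (x : Fin n → Bool) :
    stdWeight s x = 1 / (2 * s) * ∑ j, if x j = true then (1 : ℝ) else -1 := by
  have h : ∀ j : Fin n, (if x j = true then (1 : ℝ) else -1) =
      2 * (if x j = true then 1 else 0) - 1 := fun j => by split_ifs <;> norm_num
  rw [stdWeight, weight_eq_sum, Finset.sum_congr rfl fun j _ => h j, Finset.sum_sub_distrib,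
    ← Finset.mul_sum, Finset.sum_const, Finset.card_univ, Fintype.card_fin, nsmul_one]
  rcases eq_or_ne s 0 with rfl | hs
  · simp
  · field_simp

/-- Discrete integration by parts on the cube. -/
lemma sum_stdWeight_mul {n : ℕ} (s : ℝ) (f : ℝ → ℝ) :
    ∑ x : Fin n → Bool, stdWeight s x * f (stdWeight s x) =
      1 / (4 * s) * ∑ j : Fin n, ∑ x : Fin n → Bool,
        (f (stdWeight s (Function.update x j false) + 1 / s) -
          f (stdWeight s (Function.update x j false))) := by
  have h : ∀ x : Fin n → Bool, stdWeight s x * f (stdWeight s x) =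
      1 / (2 * s) * ∑ j, (if x j = true then (1 : ℝ) else -1) * f (stdWeight s x) := fun x => by
    rw [← Finset.sum_mul, ← mul_assoc, ← stdWeight_eq_sum]
  rw [Finset.sum_congr rfl fun x _ => h x, ← Finset.mul_sum, Finset.sum_comm]
  have h2 : ∀ j : Fin n, ∑ x : Fin n → Bool, (if x j = true then (1 : ℝ) else -1) *
      f (stdWeight s x) = 1 / 2 * ∑ x : Fin n → Bool,
        (f (stdWeight s (Function.update x j false) + 1 / s) -
          f (stdWeight s (Function.update x j false))) := fun j => by
    simpa only [stdWeight_update_true] using sum_sign_mul j fun x => f (stdWeight s x)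
  rw [Finset.sum_congr rfl fun j _ => h2 j, ← Finset.mul_sum, ← mul_assoc]
  congr 1
  rcases eq_or_ne s 0 with rfl | hs
  · simp
  · field_simp; norm_num

lemma sum_stdWeight_sq {n : ℕ} (s : ℝ) :
    ∑ x : Fin n → Bool, stdWeight s x ^ 2 = n / (4 * s ^ 2) * 2 ^ n := by
  have h := sum_stdWeight_mul (n := n) s id
  simp only [id, add_sub_cancel_left, Finset.sum_const, Finset.card_univ, Fintype.card_fin,
    nsmul_eq_mul, Fintype.card_pi, Fintype.card_bool, Finset.prod_const] at h
  simp only [pow_two (stdWeight s _), h]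
  push_cast
  rcases eq_or_ne s 0 with rfl | hs
  · simp
  · field_simp

lemma eq_update_false_or {n : ℕ} (s : ℝ) (x : Fin n → Bool) (j : Fin n) :
    stdWeight s x = stdWeight s (Function.update x j false) ∨
      stdWeight s x = stdWeight s (Function.update x j false) + 1 / s := by
  rw [← stdWeight_update_true]
  have hx : Function.update x j (x j) = x := Function.update_eq_self j x
  rcases hb : x j with _ | _ <;> rw [hb] at hx <;> simp [hx]

/-- The uniform probability of `W ≤ u` on the cube, where `W` is the weight centred and scaled
by `s`. -/
noncomputable def cubeCDF (n : ℕ) (s u : ℝ) : ℝ :=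
  (∑ x : Fin n → Bool, if stdWeight s x ≤ u then (1 : ℝ) else 0) / 2 ^ n

lemma sum_steinSol_bound {n : ℕ} (s z : ℝ) :
    |(∑ x : Fin n → Bool, stdWeight s x * steinSol z (stdWeight s x)) / 2 ^ n| ≤
      1 + n / (4 * s ^ 2) := by
  have hp : (0 : ℝ) < 2 ^ n := by positivity
  rw [abs_div, abs_of_pos hp, div_le_iff₀ hp]
  refine (Finset.abs_sum_le_sum_abs _ _).trans ?_
  have h : ∀ x : Fin n → Bool, |stdWeight s x * steinSol z (stdWeight s x)| ≤
      1 + stdWeight s x ^ 2 := fun x => by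
    rw [abs_mul, abs_of_nonneg (steinSol_nonneg _ _), ← sq_abs]
    have := steinSol_le_two z (stdWeight s x)
    nlinarith [abs_nonneg (stdWeight s x), sq_nonneg (|stdWeight s x| - 1)]
  refine (Finset.sum_le_sum fun x _ => h x).trans ?_
  rw [Finset.sum_add_distrib, sum_stdWeight_sq, add_mul]
  simp

lemma sum_abs_stdWeight_le {n : ℕ} (s : ℝ) :
    ∑ x : Fin n → Bool, (|stdWeight s x| + 2) ≤ (5 / 2 + n / (4 * s ^ 2) / 2) * 2 ^ n := by
  have h : ∀ x : Fin n → Bool, |stdWeight s x| + 2 ≤ 5 / 2 + stdWeight s x ^ 2 / 2 := fun x => by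
    rw [← sq_abs]
    nlinarith [sq_nonneg (|stdWeight s x| - 1)]
  refine (Finset.sum_le_sum fun x _ => h x).trans ?_
  rw [Finset.sum_add_distrib, ← Finset.sum_div _ (fun x => stdWeight s x ^ 2), sum_stdWeight_sq]
  simp
  linarith

/-- Stein's method on the cube, upper estimate of the normal distribution function. -/
lemma stdCDF_le_cubeCDF {n : ℕ} {s : ℝ} (hs : 0 < s) (z : ℝ) :
    n / (4 * s ^ 2) * (stdCDF z - cubeCDF n s (z + 1 / s)) ≤
      |n / (4 * s ^ 2) - 1| * (1 + n / (4 * s ^ 2)) +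
        n / (4 * s ^ 2) * (5 / 2 + n / (4 * s ^ 2) / 2) / s := by
  set v : ℝ := n / (4 * s ^ 2) with hv
  have hv0 : 0 ≤ v := by positivity
  have hp : (0 : ℝ) < 2 ^ n := by positivity
  set E := (∑ x : Fin n → Bool, stdWeight s x * steinSol z (stdWeight s x)) / 2 ^ n with hE
  have e1 : ∑ x : Fin n → Bool, stdWeight s x * steinSol z (stdWeight s x) = E * 2 ^ n := by
    rw [hE, div_mul_cancel₀ _ hp.ne']
  have hEb : |E| ≤ 1 + v := sum_steinSol_bound s z
  have h1 : ∀ (j : Fin n) (x : Fin n → Bool),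
      steinSol z (stdWeight s (Function.update x j false) + 1 / s) -
        steinSol z (stdWeight s (Function.update x j false)) ≤
      (stdWeight s x * steinSol z (stdWeight s x) + (|stdWeight s x| + 2) * (1 / s) +
        (if stdWeight s x ≤ z + 1 / s then 1 else 0) - stdCDF z) * (1 / s) := fun j x =>
    steinSol_increment_le (by positivity) (eq_update_false_or s x j)
  have h2 : E ≤ v * (E + (5 / 2 + v / 2) / s + cubeCDF n s (z + 1 / s) - stdCDF z) := by
    refine le_of_mul_le_mul_right ?_ hp
    conv_lhs => rw [← e1, sum_stdWeight_mul]
    refine (mul_le_mul_of_nonneg_left (Finset.sum_le_sum fun j _ => Finset.sum_le_sum fun x _ =>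
      h1 j x) (by positivity)).trans ?_
    rw [Finset.sum_const, Finset.card_univ, Fintype.card_fin, nsmul_eq_mul, ← Finset.sum_mul,
      Finset.sum_sub_distrib, Finset.sum_add_distrib, Finset.sum_add_distrib, ← Finset.sum_mul]
    have h3 := sum_abs_stdWeight_le (n := n) s
    rw [← hv] at h3
    have e2 : ∑ x : Fin n → Bool, (if stdWeight s x ≤ z + 1 / s then (1 : ℝ) else 0) =
        cubeCDF n s (z + 1 / s) * 2 ^ n := by
      rw [cubeCDF, div_mul_cancel₀ _ hp.ne']
    have e3 : ∑ _x : Fin n → Bool, stdCDF z = stdCDF z * 2 ^ n := by simp [mul_comm]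
    have e4 : ∀ t : ℝ, 1 / (4 * s) * (n * (t * (1 / s))) = v * t := fun t => by
      rw [hv]; field_simp
    rw [e1, e2, e3, e4, mul_assoc v]
    refine mul_le_mul_of_nonneg_left ?_ hv0
    have := mul_le_mul_of_nonneg_right h3 (show 0 ≤ 1 / s by positivity)
    have e5 : (5 / 2 + v / 2) * 2 ^ n * (1 / s) = (5 / 2 + v / 2) / s * 2 ^ n := by ring
    rw [e5] at this
    linarith
  have h4 : (v - 1) * E ≤ |v - 1| * (1 + v) :=
    (le_abs_self _).trans (by rw [abs_mul]; exact mul_le_mul_of_nonneg_left hEb (abs_nonneg _))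
  have h5 : v * (5 / 2 + v / 2) / s = v * ((5 / 2 + v / 2) / s) := by ring
  rw [h5]
  linarith

/-- Stein's method on the cube, lower estimate of the normal distribution function. -/
lemma cubeCDF_le_stdCDF {n : ℕ} {s : ℝ} (hs : 0 < s) (z : ℝ) :
    n / (4 * s ^ 2) * (cubeCDF n s (z - 1 / s) - stdCDF z) ≤
      |n / (4 * s ^ 2) - 1| * (1 + n / (4 * s ^ 2)) +
        n / (4 * s ^ 2) * (5 / 2 + n / (4 * s ^ 2) / 2) / s := by
  set v : ℝ := n / (4 * s ^ 2) with hv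
  have hv0 : 0 ≤ v := by positivity
  have hp : (0 : ℝ) < 2 ^ n := by positivity
  set E := (∑ x : Fin n → Bool, stdWeight s x * steinSol z (stdWeight s x)) / 2 ^ n with hE
  have e1 : ∑ x : Fin n → Bool, stdWeight s x * steinSol z (stdWeight s x) = E * 2 ^ n := by
    rw [hE, div_mul_cancel₀ _ hp.ne']
  have hEb : |E| ≤ 1 + v := sum_steinSol_bound s z
  have h1 : ∀ (j : Fin n) (x : Fin n → Bool),
      (stdWeight s x * steinSol z (stdWeight s x) - (|stdWeight s x| + 2) * (1 / s) +
        (if stdWeight s x ≤ z - 1 / s then 1 else 0) - stdCDF z) * (1 / s) ≤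
      steinSol z (stdWeight s (Function.update x j false) + 1 / s) -
        steinSol z (stdWeight s (Function.update x j false)) := fun j x =>
    le_steinSol_increment (by positivity) (eq_update_false_or s x j)
  have h2 : v * (E - (5 / 2 + v / 2) / s + cubeCDF n s (z - 1 / s) - stdCDF z) ≤ E := by
    refine le_of_mul_le_mul_right ?_ hp
    conv_rhs => rw [← e1, sum_stdWeight_mul]
    refine le_trans ?_ (mul_le_mul_of_nonneg_left (Finset.sum_le_sum fun j _ =>
      Finset.sum_le_sum fun x _ => h1 j x) (by positivity))
    rw [Finset.sum_const, Finset.card_univ, Fintype.card_fin, nsmul_eq_mul, ← Finset.sum_mul,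
      Finset.sum_sub_distrib, Finset.sum_add_distrib, Finset.sum_sub_distrib, ← Finset.sum_mul]
    have h3 := sum_abs_stdWeight_le (n := n) s
    rw [← hv] at h3
    have e2 : ∑ x : Fin n → Bool, (if stdWeight s x ≤ z - 1 / s then (1 : ℝ) else 0) =
        cubeCDF n s (z - 1 / s) * 2 ^ n := by
      rw [cubeCDF, div_mul_cancel₀ _ hp.ne']
    have e3 : ∑ _x : Fin n → Bool, stdCDF z = stdCDF z * 2 ^ n := by simp [mul_comm]
    have e4 : ∀ t : ℝ, 1 / (4 * s) * (n * (t * (1 / s))) = v * t := fun t => by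
      rw [hv]; field_simp
    rw [e1, e2, e3, e4, mul_assoc v]
    refine mul_le_mul_of_nonneg_left ?_ hv0
    have := mul_le_mul_of_nonneg_right h3 (show 0 ≤ 1 / s by positivity)
    have e5 : (5 / 2 + v / 2) * 2 ^ n * (1 / s) = (5 / 2 + v / 2) / s * 2 ^ n := by ring
    rw [e5] at this
    linarith
  have h4 : -((v - 1) * E) ≤ |v - 1| * (1 + v) :=
    (neg_le_abs _).trans (by rw [abs_mul]; exact mul_le_mul_of_nonneg_left hEb (abs_nonneg _))
  have h5 : v * (5 / 2 + v / 2) / s = v * ((5 / 2 + v / 2) / s) := by ring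
  rw [h5]
  linarith

end CubeStein

section Walsh

/-- The sign `(-1)^b`. -/
def boolSign (b : Bool) : ℝ := if b = true then -1 else 1

/-- The Walsh character of the cube indexed by `S`. -/
def walsh {n : ℕ} (S : Finset (Fin n)) (x : Fin n → Bool) : ℝ := ∏ j ∈ S, boolSign (x j)

/-- The points of the cube of weight `s`. -/
def layer (n s : ℕ) : Finset (Fin n → Bool) := Finset.univ.filter fun x => weight x = s

lemma mem_layer {n s : ℕ} {x : Fin n → Bool} :
    x ∈ layer n s ↔ (Finset.univ.filter fun j => x j = true).card = s := by
  rw [layer, Finset.mem_filter, weight]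
  exact and_iff_right (Finset.mem_univ x)

/-- The sum of a Walsh character over a layer. -/
def layerSum (n s : ℕ) (S : Finset (Fin n)) : ℝ := ∑ x ∈ layer n s, walsh S x

lemma boolSign_sq (b : Bool) : boolSign b * boolSign b = 1 := by cases b <;> simp [boolSign]

lemma abs_boolSign (b : Bool) : |boolSign b| = 1 := by cases b <;> simp [boolSign]

lemma abs_walsh {n : ℕ} (S : Finset (Fin n)) (x : Fin n → Bool) : |walsh S x| = 1 := by
  simp [walsh, Finset.abs_prod, abs_boolSign]

lemma walsh_univ {n : ℕ} (x : Fin n → Bool) : walsh Finset.univ x = (-1) ^ weight x := by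
  simp [walsh, boolSign, weight, Finset.prod_ite]

lemma walsh_compl {n : ℕ} (S : Finset (Fin n)) (x : Fin n → Bool) :
    walsh Sᶜ x = (-1) ^ weight x * walsh S x := by
  rw [← walsh_univ, walsh, walsh, walsh, ← Finset.prod_mul_prod_compl S, mul_right_comm,
    ← Finset.prod_mul_distrib]
  simp [boolSign_sq]

lemma sum_walsh_mul_walsh {n : ℕ} (x y : Fin n → Bool) :
    ∑ S, walsh S x * walsh S y = if x = y then 2 ^ n else 0 := by
  have h : ∑ S : Finset (Fin n), walsh S x * walsh S y =
      ∏ j, (1 + boolSign (x j) * boolSign (y j)) := by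
    rw [Finset.prod_one_add, Finset.powerset_univ]
    simp [walsh, Finset.prod_mul_distrib]
  rw [h]
  split_ifs with hxy
  · subst hxy
    simp [boolSign_sq]
    norm_num
  · obtain ⟨j, hj⟩ := Function.ne_iff.1 hxy
    refine Finset.prod_eq_zero (Finset.mem_univ j) ?_
    revert hj
    cases x j <;> cases y j <;> simp [boolSign]

lemma card_layer (n s : ℕ) : (layer n s).card = n.choose s := by
  have h : n.choose s = (Finset.powersetCard s (Finset.univ : Finset (Fin n))).card := by simp
  rw [h]
  refine Finset.card_bij' (fun x _ => Finset.univ.filter fun j => x j = true)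
    (fun T _ j => decide (j ∈ T)) ?_ ?_ ?_ ?_
  · intro x hx
    simpa [Finset.mem_powersetCard] using mem_layer.1 hx
  · intro T hT
    exact mem_layer.2 (by simpa [Finset.mem_powersetCard] using hT)
  · intro x _
    ext j
    simp
  · intro T _
    ext j
    simp

lemma sum_layerSum_sq (n s : ℕ) :
    ∑ S, layerSum n s S ^ 2 = 2 ^ n * (n.choose s : ℝ) := by
  simp only [layerSum, pow_two, Finset.sum_mul_sum]
  rw [Finset.sum_comm]
  have h : ∀ x ∈ layer n s, ∑ S, ∑ y ∈ layer n s, walsh S x * walsh S y = 2 ^ n := by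
    intro x hx
    rw [Finset.sum_comm]
    simp [sum_walsh_mul_walsh, hx]
  rw [Finset.sum_congr rfl h, Finset.sum_const, card_layer, nsmul_eq_mul, mul_comm]

lemma abs_layerSum_le (n s : ℕ) (S : Finset (Fin n)) : |layerSum n s S| ≤ n.choose s := by
  rw [← card_layer]
  refine (Finset.abs_sum_le_sum_abs _ _).trans ?_
  simp [abs_walsh]

lemma layerSum_empty (n s : ℕ) : layerSum n s ∅ = n.choose s := by
  simp [layerSum, walsh, card_layer]

lemma layerSum_compl (n s : ℕ) (S : Finset (Fin n)) :
    layerSum n s Sᶜ = (-1) ^ s * layerSum n s S := by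
  rw [layerSum, layerSum, Finset.mul_sum]
  refine Finset.sum_congr rfl fun x hx => ?_
  rw [walsh_compl, (Finset.mem_filter.1 hx).2]

lemma layerSum_map (n s : ℕ) (σ : Equiv.Perm (Fin n)) (S : Finset (Fin n)) :
    layerSum n s (S.map σ.toEmbedding) = layerSum n s S := by
  rw [layerSum, layerSum]
  refine Finset.sum_nbij' (fun x => x ∘ σ) (fun x => x ∘ σ.symm) ?_ ?_ ?_ ?_ ?_
  · intro x hx
    rw [mem_layer] at hx ⊢
    rw [← hx]
    exact Finset.card_bij' (fun j _ => σ j) (fun j _ => σ.symm j) (by simp) (by simp) (by simp)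
      (by simp)
  · intro x hx
    rw [mem_layer] at hx ⊢
    rw [← hx]
    exact Finset.card_bij' (fun j _ => σ.symm j) (fun j _ => σ j) (by simp) (by simp) (by simp)
      (by simp)
  · intro x _
    ext j
    simp
  · intro x _
    ext j
    simp
  · intro x _
    simp [walsh]

lemma exists_perm_map_eq {n : ℕ} {S T : Finset (Fin n)} (h : S.card = T.card) :
    ∃ σ : Equiv.Perm (Fin n), S.map σ.toEmbedding = T := by
  classical
  let e : {x // x ∈ S} ≃ {x // x ∈ T} := Finset.equivOfCardEq h
  refine ⟨e.extendSubtype, Finset.eq_of_subset_of_card_le ?_ (by simp [h])⟩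
  intro y hy
  obtain ⟨x, hx, rfl⟩ := Finset.mem_map.1 hy
  exact e.extendSubtype_mem x hx

lemma layerSum_eq_of_card_eq (n s : ℕ) {S T : Finset (Fin n)} (h : S.card = T.card) :
    layerSum n s S = layerSum n s T := by
  obtain ⟨σ, rfl⟩ := exists_perm_map_eq h
  exact (layerSum_map n s σ S).symm

lemma choose_mul_layerSum_sq_le (n s : ℕ) (S : Finset (Fin n)) :
    (n.choose S.card : ℝ) * layerSum n s S ^ 2 ≤ 2 ^ n * (n.choose s : ℝ) := by
  rw [← sum_layerSum_sq]
  have h : ∑ T ∈ Finset.univ.powersetCard S.card, layerSum n s T ^ 2 =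
      (n.choose S.card : ℝ) * layerSum n s S ^ 2 := by
    rw [Finset.sum_congr rfl fun T hT => by
      rw [layerSum_eq_of_card_eq n s (Finset.mem_powersetCard.1 hT).2]]
    simp
  rw [← h]
  exact Finset.sum_le_sum_of_subset_of_nonneg (Finset.subset_univ _) fun _ _ _ => sq_nonneg _

lemma layerSum_of_card_eq_one (n s : ℕ) {S : Finset (Fin n)} (hS : S.card = 1) :
    n * layerSum n s S = (n - 2 * s) * n.choose s := by
  have h : ∑ j : Fin n, layerSum n s {j} = n * layerSum n s S := by
    rw [Finset.sum_congr rfl fun j _ =>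
      layerSum_eq_of_card_eq n s ((Finset.card_singleton j).trans hS.symm)]
    simp
  rw [← h]
  simp only [layerSum]
  rw [Finset.sum_comm]
  have h2 : ∀ x ∈ layer n s, ∑ j : Fin n, walsh {j} x = n - 2 * s := by
    intro x hx
    have h3 : ∀ j : Fin n, walsh {j} x = 1 - 2 * (if x j = true then 1 else 0) := fun j => by
      simp only [walsh, Finset.prod_singleton, boolSign]
      split_ifs <;> norm_num
    rw [Finset.sum_congr rfl fun j _ => h3 j, Finset.sum_sub_distrib, ← Finset.mul_sum,
      ← weight_eq_sum, (Finset.mem_filter.1 hx).2]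
    simp
  rw [Finset.sum_congr rfl h2, Finset.sum_const, card_layer, nsmul_eq_mul, mul_comm]

/-- The eigenvalue of one stage toggling `s` bulbs on the Walsh character indexed by `S`. -/
noncomputable def stageEigen (n s : ℕ) (S : Finset (Fin n)) : ℝ := layerSum n s S / n.choose s

lemma abs_stageEigen_le_one (n s : ℕ) (S : Finset (Fin n)) : |stageEigen n s S| ≤ 1 := by
  rw [stageEigen, abs_div, Nat.abs_cast]
  exact div_le_one_of_le₀ (abs_layerSum_le n s S) (Nat.cast_nonneg _)

lemma stageEigen_empty {n s : ℕ} (hs : s ≤ n) : stageEigen n s ∅ = 1 := by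
  rw [stageEigen, layerSum_empty, div_self]
  exact_mod_cast (Nat.choose_pos hs).ne'

lemma stageEigen_compl (n s : ℕ) (S : Finset (Fin n)) :
    stageEigen n s Sᶜ = (-1) ^ s * stageEigen n s S := by
  rw [stageEigen, stageEigen, layerSum_compl, mul_div_assoc]

lemma abs_stageEigen_compl (n s : ℕ) (S : Finset (Fin n)) :
    |stageEigen n s Sᶜ| = |stageEigen n s S| := by
  simp [stageEigen_compl, abs_mul]

lemma choose_mul_stageEigen_sq_le {n s : ℕ} (hs : s ≤ n) (S : Finset (Fin n)) :
    (n.choose S.card : ℝ) * stageEigen n s S ^ 2 ≤ 2 ^ n / n.choose s := by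
  have hc : (0 : ℝ) < n.choose s := by exact_mod_cast Nat.choose_pos hs
  rw [stageEigen, div_pow, ← mul_div_assoc, div_le_div_iff₀ (by positivity) hc]
  nlinarith [mul_le_mul_of_nonneg_right (choose_mul_layerSum_sq_le n s S) hc.le]

lemma stageEigen_of_card_eq_one {n s : ℕ} (hs : s ≤ n) {S : Finset (Fin n)} (hS : S.card = 1) :
    n * stageEigen n s S = n - 2 * s := by
  have hc : (n.choose s : ℝ) ≠ 0 := by exact_mod_cast (Nat.choose_pos hs).ne'
  rw [stageEigen, ← mul_div_assoc, layerSum_of_card_eq_one n s hS, mul_div_cancel_right₀ _ hc]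

end Walsh

section LightbulbWalk

/-- The eigenvalue of the whole process on the Walsh character indexed by `S`. -/
noncomputable def processEigen (n : ℕ) (S : Finset (Fin n)) : ℝ :=
  ∏ r : Fin n, stageEigen n (r + 1) S

lemma validArrays_eq_piFinset (n : ℕ) :
    validArrays n n (stdPattern n) = Fintype.piFinset fun r : Fin n => layer n (r + 1) := by
  ext e
  rw [validArrays, Finset.mem_filter, Fintype.mem_piFinset]
  simp only [mem_layer, Finset.mem_univ, true_and, stdPattern]

lemma boolSign_bulbOn {n k : ℕ} (e : Fin k → Fin n → Bool) (j : Fin n) :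
    boolSign (bulbOn e j) = ∏ r, boolSign (e r j) := by
  have h : ∏ r, boolSign (e r j) = (-1) ^ (Finset.univ.filter fun r => e r j = true).card := by
    simp [boolSign, Finset.prod_ite]
  rw [h, bulbOn, boolSign]
  rcases Nat.mod_two_eq_zero_or_one (Finset.univ.filter fun r => e r j = true).card with h2 | h2
  · rw [Even.neg_one_pow (Nat.even_iff.2 h2)]; simp [h2]
  · rw [Odd.neg_one_pow (Nat.odd_iff.2 h2)]; simp [h2]

lemma walsh_bulbOn {n k : ℕ} (e : Fin k → Fin n → Bool) (S : Finset (Fin n)) :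
    walsh S (bulbOn e) = ∏ r, walsh S (e r) := by
  simp only [walsh, boolSign_bulbOn]
  exact Finset.prod_comm

lemma card_validArrays (n : ℕ) :
    ((validArrays n n (stdPattern n)).card : ℝ) = ∏ r : Fin n, (n.choose (r + 1) : ℝ) := by
  rw [validArrays_eq_piFinset, Fintype.card_piFinset]
  push_cast [card_layer]
  rfl

lemma card_validArrays_pos (n : ℕ) : (0 : ℝ) < (validArrays n n (stdPattern n)).card := by
  rw [card_validArrays]
  exact Finset.prod_pos fun r _ => by exact_mod_cast Nat.choose_pos r.2

lemma sum_validArrays_walsh (n : ℕ) (S : Finset (Fin n)) :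
    ∑ e ∈ validArrays n n (stdPattern n), walsh S (bulbOn e) =
      processEigen n S * (validArrays n n (stdPattern n)).card := by
  rw [card_validArrays, validArrays_eq_piFinset, processEigen, ← Finset.prod_mul_distrib]
  simp only [walsh_bulbOn]
  rw [Finset.sum_congr rfl fun e _ => rfl, ← Finset.prod_univ_sum]
  refine Finset.prod_congr rfl fun r _ => ?_
  rw [stageEigen, div_mul_cancel₀]
  · rfl
  · exact_mod_cast (Nat.choose_pos r.2).ne'

/-- The probability, under the lightbulb process, that the terminal state lies in `B`. -/
noncomputable def terminalProb (n : ℕ) (B : Finset (Fin n → Bool)) : ℝ :=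
  ((validArrays n n (stdPattern n)).filter fun e => bulbOn e ∈ B).card /
    (validArrays n n (stdPattern n)).card

lemma terminalProb_eq_sum (n : ℕ) (B : Finset (Fin n → Bool)) :
    terminalProb n B = (∑ S, processEigen n S * ∑ y ∈ B, walsh S y) / 2 ^ n := by
  have hc := card_validArrays_pos n
  rw [terminalProb, div_eq_div_iff hc.ne' (by positivity)]
  have h : ∀ x : Fin n → Bool, (if x ∈ B then (1 : ℝ) else 0) * 2 ^ n =
      ∑ S, walsh S x * ∑ y ∈ B, walsh S y := fun x => by
    simp only [Finset.mul_sum]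
    rw [Finset.sum_comm]
    simp [sum_walsh_mul_walsh]
  rw [Finset.card_filter]
  push_cast
  rw [Finset.sum_mul]
  simp only [h]
  rw [Finset.sum_comm, Finset.sum_mul]
  refine Finset.sum_congr rfl fun S _ => ?_
  rw [← Finset.sum_mul, sum_validArrays_walsh]
  ring

lemma processEigen_empty (n : ℕ) : processEigen n ∅ = 1 :=
  Finset.prod_eq_one fun r _ => stageEigen_empty r.2

lemma processEigen_univ (n : ℕ) : processEigen n Finset.univ = 1 ∨
    processEigen n Finset.univ = -1 := by
  have h : processEigen n Finset.univ = (-1) ^ ∑ r : Fin n, ((r : ℕ) + 1) := by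
    rw [processEigen, ← Finset.prod_pow_eq_pow_sum]
    refine Finset.prod_congr rfl fun r _ => ?_
    rw [← Finset.compl_empty, stageEigen_compl, stageEigen_empty r.2, mul_one]
  rw [h]
  exact neg_one_pow_eq_or ℝ _

/-- The distance between the terminal distribution and the uniform distribution on a parity class,
in terms of the nontrivial eigenvalues. -/
lemma abs_terminalProb_sub_le {n : ℕ} (hn : 0 < n) (B : Finset (Fin n → Bool)) :
    |terminalProb n B -
        (∑ y ∈ B, (1 + processEigen n Finset.univ * walsh Finset.univ y)) / 2 ^ n| ≤
      ∑ S : Finset (Fin n), if S = ∅ ∨ S = Finset.univ then 0 else |processEigen n S| := by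
  have hp : (0 : ℝ) < 2 ^ n := by positivity
  have hne : (Finset.univ : Finset (Fin n)) ≠ ∅ := by
    have : Nonempty (Fin n) := ⟨⟨0, hn⟩⟩
    exact Finset.univ_nonempty.ne_empty
  have h1 : ∑ S, processEigen n S * ∑ y ∈ B, walsh S y =
      (∑ S : Finset (Fin n), if S = ∅ ∨ S = Finset.univ then 0 else
        processEigen n S * ∑ y ∈ B, walsh S y) +
      ∑ y ∈ B, (1 + processEigen n Finset.univ * walsh Finset.univ y) := by
    have h2 : ∀ S : Finset (Fin n), processEigen n S * ∑ y ∈ B, walsh S y =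
        (if S = ∅ ∨ S = Finset.univ then 0 else processEigen n S * ∑ y ∈ B, walsh S y) +
        ((if S = ∅ then processEigen n S * ∑ y ∈ B, walsh S y else 0) +
          if S = Finset.univ then processEigen n S * ∑ y ∈ B, walsh S y else 0) := fun S => by
      by_cases hS : S = ∅
      · have : S ≠ Finset.univ := fun h => hne (h ▸ hS)
        simp [hS, hne.symm]
      · simp only [hS, false_or, if_false, zero_add]
        split_ifs <;> simp
    rw [Finset.sum_congr rfl fun S _ => h2 S, Finset.sum_add_distrib, Finset.sum_add_distrib,
      Finset.sum_ite_eq' , Finset.sum_ite_eq', Finset.sum_add_distrib, Finset.mul_sum]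
    simp [processEigen_empty, walsh]
    simp [Finset.mul_sum]
  rw [terminalProb_eq_sum, h1, ← sub_div, add_sub_cancel_right, abs_div, abs_of_pos hp,
    div_le_iff₀ hp, Finset.sum_mul]
  refine (Finset.abs_sum_le_sum_abs _ _).trans (Finset.sum_le_sum fun S _ => ?_)
  split_ifs
  · simp
  · rw [abs_mul]
    refine mul_le_mul_of_nonneg_left ?_ (abs_nonneg _)
    refine (Finset.abs_sum_le_sum_abs _ _).trans ?_
    simp only [abs_walsh, Finset.sum_const, nsmul_one]
    exact_mod_cast (Finset.card_le_univ B).trans_eq (by simp)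

lemma abs_stdWeight_flipAt_sub_le {n : ℕ} {s : ℝ} (hs : 0 < s) (x : Fin n → Bool) (j : Fin n) :
    |stdWeight s (flipAt j x) - stdWeight s x| ≤ 1 / s := by
  have h0 : 0 < 1 / s := by positivity
  have h1 := eq_update_false_or s x j
  have h2 := eq_update_false_or s (flipAt j x) j
  rw [flipAt, Function.update_idem] at h2
  rw [flipAt, abs_le]
  rcases h1 with h1 | h1 <;> rcases h2 with h2 | h2 <;> rw [h1, h2] <;> constructor <;> linarith

lemma walsh_univ_flipAt {n : ℕ} (x : Fin n → Bool) (j : Fin n) :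
    walsh Finset.univ (flipAt j x) = -walsh Finset.univ x := by
  rw [walsh, walsh, ← Finset.mul_prod_erase _ _ (Finset.mem_univ j),
    ← Finset.mul_prod_erase _ (fun i => boolSign (x i)) (Finset.mem_univ j), ← neg_mul]
  congr 1
  · cases h : x j <;> simp [flipAt, boolSign, h]
  · refine Finset.prod_congr rfl fun i hi => ?_
    rw [flipAt, Function.update_of_ne (Finset.ne_of_mem_erase hi)]

lemma sum_parity_eq {n : ℕ} (hn : 0 < n) (ε s z : ℝ) :
    ∑ y ∈ Finset.univ.filter fun x : Fin n → Bool => stdWeight s x ≤ z,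
        (1 + ε * walsh Finset.univ y) =
      ∑ y : Fin n → Bool, ((1 + ε * walsh Finset.univ y) / 2 *
          (if stdWeight s y ≤ z then 1 else 0) +
        (1 - ε * walsh Finset.univ y) / 2 *
          (if stdWeight s (flipAt ⟨0, hn⟩ y) ≤ z then 1 else 0)) := by
  have h := sum_comp_flipAt (⟨0, hn⟩ : Fin n) fun y =>
    (1 + ε * walsh Finset.univ y) / 2 * (if stdWeight s y ≤ z then 1 else 0)
  simp only [walsh_univ_flipAt] at h
  simp only [mul_neg, ← sub_eq_add_neg] at h
  conv_rhs => rw [Finset.sum_add_distrib, h, ← Finset.sum_add_distrib]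
  rw [Finset.sum_filter]
  refine Finset.sum_congr rfl fun y _ => ?_
  split_ifs <;> ring

lemma sum_parity_le {n : ℕ} (hn : 0 < n) {ε s : ℝ} (hε : |ε| ≤ 1) (hs : 0 < s) (z : ℝ) :
    (∑ y ∈ Finset.univ.filter fun x : Fin n → Bool => stdWeight s x ≤ z,
        (1 + ε * walsh Finset.univ y)) / 2 ^ n ≤ cubeCDF n s (z + 1 / s) := by
  rw [cubeCDF, sum_parity_eq hn]
  refine div_le_div_of_nonneg_right (Finset.sum_le_sum fun y _ => ?_) (by positivity)
  have h1 : |ε * walsh Finset.univ y| ≤ 1 := by rwa [abs_mul, abs_walsh, mul_one]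
  have h2 := abs_le.1 (abs_stdWeight_flipAt_sub_le hs y ⟨0, hn⟩)
  have h0 : 0 < 1 / s := by positivity
  obtain ⟨h3, h4⟩ := abs_le.1 h1
  split_ifs <;> linarith

lemma le_sum_parity {n : ℕ} (hn : 0 < n) {ε s : ℝ} (hε : |ε| ≤ 1) (hs : 0 < s) (z : ℝ) :
    cubeCDF n s (z - 1 / s) ≤
      (∑ y ∈ Finset.univ.filter fun x : Fin n → Bool => stdWeight s x ≤ z,
        (1 + ε * walsh Finset.univ y)) / 2 ^ n := by
  rw [cubeCDF, sum_parity_eq hn]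
  refine div_le_div_of_nonneg_right (Finset.sum_le_sum fun y _ => ?_) (by positivity)
  have h1 : |ε * walsh Finset.univ y| ≤ 1 := by rwa [abs_mul, abs_walsh, mul_one]
  have h2 := abs_le.1 (abs_stdWeight_flipAt_sub_le hs y ⟨0, hn⟩)
  have h0 : 0 < 1 / s := by positivity
  obtain ⟨h3, h4⟩ := abs_le.1 h1
  split_ifs <;> linarith

end LightbulbWalk

section SpectralBound

lemma two_pow_le_mul_choose {m s : ℕ} (hm : 144 ≤ m) (h1 : m - 5 ≤ s) (h2 : s ≤ m + 6) :
    2 ^ (2 * m + 1) ≤ 2 * (2 * m + 2) * (2 * m + 1).choose s := by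
  have step : ∀ k, m - 5 ≤ k → k < m →
      14 * (2 * m + 1).choose (k + 1) ≤ 15 * (2 * m + 1).choose k := by
    intro k hk hk'
    refine Nat.le_of_mul_le_mul_right ?_ (Nat.succ_pos k)
    have h := Nat.choose_succ_right_eq (2 * m + 1) k
    have h3 : 14 * (2 * m + 1 - k) ≤ 15 * (k + 1) := by omega
    calc 14 * (2 * m + 1).choose (k + 1) * (k + 1)
        = (2 * m + 1).choose k * (14 * (2 * m + 1 - k)) := by rw [mul_assoc, h]; ring
      _ ≤ (2 * m + 1).choose k * (15 * (k + 1)) := Nat.mul_le_mul_left _ h3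
      _ = 15 * (2 * m + 1).choose k * (k + 1) := by ring
  have chain : ∀ j ≤ 5, 14 ^ j * (2 * m + 1).choose m ≤ 15 ^ j * (2 * m + 1).choose (m - j) := by
    intro j
    induction j with
    | zero => simp
    | succ j ih =>
      intro hj
      have h4 := step (m - (j + 1)) (by omega) (by omega)
      rw [show m - (j + 1) + 1 = m - j by omega] at h4
      have h5 := ih (by omega)
      calc 14 ^ (j + 1) * (2 * m + 1).choose m = 14 * (14 ^ j * (2 * m + 1).choose m) := by ring
        _ ≤ 14 * (15 ^ j * (2 * m + 1).choose (m - j)) := Nat.mul_le_mul_left _ h5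
        _ = 15 ^ j * (14 * (2 * m + 1).choose (m - j)) := by ring
        _ ≤ 15 ^ j * (15 * (2 * m + 1).choose (m - (j + 1))) := Nat.mul_le_mul_left _ h4
        _ = 15 ^ (j + 1) * (2 * m + 1).choose (m - (j + 1)) := by ring
  have half : ∀ j ≤ 5, (2 * m + 1).choose m ≤ 2 * (2 * m + 1).choose (m - j) := by
    intro j hj
    have h6 := chain j hj
    interval_cases j <;> norm_num at h6 ⊢ <;> omega
  have hmid : 2 ^ (2 * m + 1) ≤ (2 * m + 2) * (2 * m + 1).choose m := by
    rw [← Nat.sum_range_choose]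
    refine (Finset.sum_le_card_nsmul _ _ _ fun r _ => Nat.choose_le_middle r _).trans ?_
    rw [Finset.card_range, smul_eq_mul, show (2 * m + 1) / 2 = m by omega]
  have hs : (2 * m + 1).choose m ≤ 2 * (2 * m + 1).choose s := by
    rcases le_or_gt s m with h | h
    · have := half (m - s) (by omega)
      rwa [show m - (m - s) = s by omega] at this
    · have := half (s - (m + 1)) (by omega)
      rwa [show m - (s - (m + 1)) = 2 * m + 1 - s by omega,
        Nat.choose_symm (by omega)] at this
  calc 2 ^ (2 * m + 1) ≤ (2 * m + 2) * (2 * m + 1).choose m := hmid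
    _ ≤ (2 * m + 2) * (2 * (2 * m + 1).choose s) := Nat.mul_le_mul_left _ hs
    _ = _ := by ring

lemma choose_two_le_choose {n b : ℕ} (h1 : 2 ≤ b) (h2 : b + 2 ≤ n) :
    n.choose 2 ≤ n.choose b := by
  have key : ∀ c, 2 ≤ c → c ≤ n / 2 → n.choose 2 ≤ n.choose c := by
    intro c hc
    induction c, hc using Nat.le_induction with
    | base => exact fun _ => le_rfl
    | succ c _ ih =>
      exact fun h => (ih (by omega)).trans (Nat.choose_le_succ_of_lt_half_left (by omega))
  rcases le_or_gt b (n / 2) with h | h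
  · exact key b h1 h
  · rw [← Nat.choose_symm (show b ≤ n by omega)]
    exact key (n - b) (by omega) (by omega)

lemma abs_processEigen_le_pow {m : ℕ} (hm : 6 ≤ m) {ρ : ℝ} (S : Finset (Fin (2 * m + 1)))
    (h : ∀ s, m - 5 ≤ s → s ≤ m + 6 → |stageEigen (2 * m + 1) s S| ≤ ρ) :
    |processEigen (2 * m + 1) S| ≤ ρ ^ 12 := by
  rw [processEigen, Finset.abs_prod,
    Fin.prod_univ_eq_prod_range (fun i => |stageEigen (2 * m + 1) (i + 1) S|)]
  have hsub : Finset.Ico (m - 6) (m + 6) ⊆ Finset.range (2 * m + 1) := fun i hi => by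
    rw [Finset.mem_Ico] at hi
    rw [Finset.mem_range]
    omega
  rw [← Finset.prod_sdiff hsub]
  have h1 : ∏ i ∈ Finset.range (2 * m + 1) \ Finset.Ico (m - 6) (m + 6),
      |stageEigen (2 * m + 1) (i + 1) S| ≤ 1 :=
    Finset.prod_le_one (fun _ _ => abs_nonneg _) fun _ _ => abs_stageEigen_le_one _ _ _
  have h2 : ∏ i ∈ Finset.Ico (m - 6) (m + 6), |stageEigen (2 * m + 1) (i + 1) S| ≤ ρ ^ 12 := by
    refine (Finset.prod_le_prod (fun _ _ => abs_nonneg _) fun i hi =>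
      h (i + 1) ?_ ?_).trans_eq ?_
    · rw [Finset.mem_Ico] at hi; omega
    · rw [Finset.mem_Ico] at hi; omega
    · rw [Finset.prod_const, Nat.card_Ico, show m + 6 - (m - 6) = 12 by omega]
  exact (mul_le_of_le_one_left (Finset.prod_nonneg fun _ _ => abs_nonneg _) h1).trans h2

lemma abs_stageEigen_le_of_card_eq_one {m s : ℕ} (hm : 144 ≤ m) {S : Finset (Fin (2 * m + 1))}
    (hS : S.card = 1) (h1 : m - 5 ≤ s) (h2 : s ≤ m + 6) :
    |stageEigen (2 * m + 1) s S| ≤ 11 / ((2 * m + 1 : ℕ) : ℝ) := by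
  have h := stageEigen_of_card_eq_one (show s ≤ 2 * m + 1 by omega) hS
  have hn : (0 : ℝ) < ((2 * m + 1 : ℕ) : ℝ) := by positivity
  rw [le_div_iff₀ hn, ← abs_of_pos hn, ← abs_mul, mul_comm, h, abs_le]
  have h3 : (m : ℝ) ≤ s + 5 := by exact_mod_cast (show m ≤ s + 5 by omega)
  have h4 : (s : ℝ) ≤ m + 6 := by exact_mod_cast h2
  push_cast
  constructor <;> linarith

lemma abs_processEigen_le {m : ℕ} (hm : 144 ≤ m) {S : Finset (Fin (2 * m + 1))}
    (h0 : S ≠ ∅) (h1 : S ≠ Finset.univ) :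
    |processEigen (2 * m + 1) S| ≤
      1 / (((2 * m + 1 : ℕ) : ℝ) ^ 2 * ((2 * m + 1).choose S.card : ℝ)) := by
  have hc0 : 0 < S.card := Finset.card_pos.2 (Finset.nonempty_iff_ne_empty.2 h0)
  have hc1 : S.card < 2 * m + 1 := by
    have := (Finset.card_lt_iff_ne_univ S).2 h1
    simpa using this
  have hcc : Sᶜ.card = 2 * m + 1 - S.card := by simp [Finset.card_compl]
  have hn : (289 : ℝ) ≤ ((2 * m + 1 : ℕ) : ℝ) := by exact_mod_cast (show 289 ≤ 2 * m + 1 by omega)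
  by_cases hb : 2 ≤ S.card ∧ S.card + 2 ≤ 2 * m + 1
  · have hD : ((2 * m + 1 : ℕ) : ℝ) * (((2 * m + 1 : ℕ) : ℝ) - 1) / 2 ≤
        ((2 * m + 1).choose S.card : ℝ) := by
      rw [← Nat.cast_choose_two]
      exact_mod_cast choose_two_le_choose hb.1 hb.2
    set D : ℝ := ((2 * m + 1).choose S.card : ℝ) with hDdef
    have hst : ∀ s, m - 5 ≤ s → s ≤ m + 6 → |stageEigen (2 * m + 1) s S| ≤
        Real.sqrt (2 * (((2 * m + 1 : ℕ) : ℝ) + 1) / D) := by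
      intro s hs1 hs2
      have hsn : s ≤ 2 * m + 1 := by omega
      have hK : (2 : ℝ) ^ (2 * m + 1) / ((2 * m + 1).choose s : ℝ) ≤
          2 * (((2 * m + 1 : ℕ) : ℝ) + 1) := by
        rw [div_le_iff₀ (by exact_mod_cast Nat.choose_pos hsn)]
        exact_mod_cast two_pow_le_mul_choose hm hs1 hs2
      have hDpos : 0 < D := by rw [hDdef]; exact_mod_cast Nat.choose_pos hc1.le
      refine Real.abs_le_sqrt ?_
      rw [le_div_iff₀ hDpos, mul_comm]
      exact (choose_mul_stageEigen_sq_le hsn S).trans hK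
    have h := abs_processEigen_le_pow (by omega) S hst
    generalize ((2 * m + 1 : ℕ) : ℝ) = N at *
    have hDpos : 0 < D := by nlinarith
    refine h.trans ?_
    rw [show 12 = 2 * 6 by rfl, pow_mul, Real.sq_sqrt (by positivity)]
    have hr : 2 * (N + 1) / D ≤ 5 / N := by
      rw [div_le_div_iff₀ hDpos (by linarith)]
      nlinarith
    have h3 : 2 * (N + 1) ≤ 3 * N := by linarith
    rw [le_div_iff₀ (by positivity)]
    have e : (2 * (N + 1) / D) ^ 6 * (N ^ 2 * D) =
        (2 * (N + 1) / D) ^ 5 * (N ^ 2 * (2 * (N + 1))) := by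
      field_simp
    rw [e]
    calc (2 * (N + 1) / D) ^ 5 * (N ^ 2 * (2 * (N + 1)))
        ≤ (5 / N) ^ 5 * (N ^ 2 * (3 * N)) :=
          mul_le_mul (pow_le_pow_left₀ (by positivity) hr 5)
            (mul_le_mul_of_nonneg_left h3 (by positivity)) (by positivity) (by positivity)
      _ = 9375 / N ^ 2 := by field_simp; norm_num
      _ ≤ 1 := by rw [div_le_one (by positivity)]; nlinarith
  · have hst : ∀ s, m - 5 ≤ s → s ≤ m + 6 →
        |stageEigen (2 * m + 1) s S| ≤ 11 / ((2 * m + 1 : ℕ) : ℝ) := by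
      intro s hs1 hs2
      by_cases hS : S.card = 1
      · exact abs_stageEigen_le_of_card_eq_one hm hS hs1 hs2
      · rw [← abs_stageEigen_compl]
        exact abs_stageEigen_le_of_card_eq_one hm (by omega) hs1 hs2
    have hch : (2 * m + 1).choose S.card = 2 * m + 1 := by
      by_cases hS : S.card = 1
      · rw [hS, Nat.choose_one_right]
      · rw [← Nat.choose_symm hc1.le, show 2 * m + 1 - S.card = 1 by omega, Nat.choose_one_right]
    have h := abs_processEigen_le_pow (by omega) S hst
    rw [hch]
    generalize ((2 * m + 1 : ℕ) : ℝ) = N at *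
    refine h.trans ?_
    have hN : 0 < N := by linarith
    rw [div_pow, div_le_div_iff₀ (by positivity) (by positivity), one_mul]
    have h9 : (11 : ℝ) ^ 12 ≤ N ^ 9 := le_trans (by norm_num) (pow_le_pow_left₀ (by norm_num) hn 9)
    calc (11 : ℝ) ^ 12 * (N ^ 2 * N) ≤ N ^ 9 * (N ^ 2 * N) := by gcongr
      _ = N ^ 12 := by ring

lemma sum_abs_processEigen_le {m : ℕ} (hm : 144 ≤ m) :
    (∑ S : Finset (Fin (2 * m + 1)), if S = ∅ ∨ S = Finset.univ then 0 else
      |processEigen (2 * m + 1) S|) ≤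
      (((2 * m + 1 : ℕ) : ℝ) + 1) / ((2 * m + 1 : ℕ) : ℝ) ^ 2 := by
  have h : ∀ S : Finset (Fin (2 * m + 1)), (if S = ∅ ∨ S = Finset.univ then 0 else
      |processEigen (2 * m + 1) S|) ≤
      1 / (((2 * m + 1 : ℕ) : ℝ) ^ 2 * ((2 * m + 1).choose S.card : ℝ)) := fun S => by
    split_ifs with hS
    · positivity
    · rw [not_or] at hS
      exact abs_processEigen_le hm hS.1 hS.2
  refine (Finset.sum_le_sum fun S _ => h S).trans_eq ?_
  rw [← Finset.powerset_univ, Finset.sum_powerset_apply_card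
    (fun b => 1 / (((2 * m + 1 : ℕ) : ℝ) ^ 2 * ((2 * m + 1).choose b : ℝ))),
    Finset.card_univ, Fintype.card_fin]
  have h2 : ∀ b ∈ Finset.range (2 * m + 1 + 1), (2 * m + 1).choose b •
      (1 / (((2 * m + 1 : ℕ) : ℝ) ^ 2 * ((2 * m + 1).choose b : ℝ))) =
      1 / ((2 * m + 1 : ℕ) : ℝ) ^ 2 := fun b hb => by
    have hc : ((2 * m + 1).choose b : ℝ) ≠ 0 := by
      exact_mod_cast (Nat.choose_pos (Nat.lt_succ_iff.1 (Finset.mem_range.1 hb))).ne'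
    rw [nsmul_eq_mul]
    field_simp
  rw [Finset.sum_congr rfl h2, Finset.sum_const, Finset.card_range, nsmul_eq_mul]
  push_cast
  ring

end SpectralBound

section Variance

lemma lam_two {n s : ℕ} (hn : 2 ≤ n) :
    lam n 2 s = 1 - 4 * s * (n - s) / (n * (n - 1)) := by
  have h1 : (n : ℝ) - 1 ≠ 0 := by
    have : (2 : ℝ) ≤ n := by exact_mod_cast hn
    linarith
  have h0 : (n : ℝ) ≠ 0 := by positivity
  have hd : ∀ k : ℕ, (k.descFactorial 2 : ℝ) = k * (k - 1) := fun k => by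
    rcases k with _ | k
    · simp
    · simp [Nat.descFactorial]; ring
  simp only [lam, Finset.sum_range_succ, Finset.sum_range_zero, hd, Nat.descFactorial_one,
    Nat.descFactorial_zero]
  norm_num
  field_simp
  ring

lemma abs_lamBarFull_le {n m : ℕ} (hm : n = 2 * m + 1) (hn7 : 7 ≤ n) :
    |lamBarFull n 2 m| ≤ 1 / (n : ℝ) ^ 2 := by
  have hN : (7 : ℝ) ≤ n := by exact_mod_cast hn7
  have hmR : (n : ℝ) = 2 * m + 1 := by exact_mod_cast hm
  have hm0 : (m : ℝ) ≠ 0 := by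
    have : m ≠ 0 := by omega
    exact_mod_cast this
  have e1 : lam n 2 m = -1 / n := by
    rw [lam_two (by omega), hmR, add_sub_cancel_right]
    field_simp
    ring
  have e2 : lam n 2 (m + 1) = -1 / n := by
    rw [lam_two (by omega), hmR, add_sub_cancel_right]
    push_cast
    field_simp
    ring
  have hb : ∀ r ∈ Finset.Icc 1 n \ {m, m + 1}, |lam n 2 r| ≤ 1 := by
    intro r hr
    have hr1 := (Finset.mem_Icc.1 (Finset.mem_sdiff.1 hr).1).2
    have hrn : (r : ℝ) ≤ n := by exact_mod_cast hr1
    have hr0 : (0 : ℝ) ≤ r := Nat.cast_nonneg r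
    have hpos : 0 < (n : ℝ) * (n - 1) := by nlinarith
    rw [lam_two (by omega), abs_le]
    constructor
    · have : 4 * r * (n - r) / (n * ((n : ℝ) - 1)) ≤ 2 := by
        rw [div_le_iff₀ hpos]
        nlinarith [sq_nonneg ((n : ℝ) - 2 * r)]
      linarith
    · have : 0 ≤ 4 * r * (n - r) / (n * ((n : ℝ) - 1)) :=
        div_nonneg (mul_nonneg (by positivity) (by linarith)) hpos.le
      linarith
  rw [lamBarFull, e1, e2, abs_mul, Finset.abs_prod,
    show ((-1 / (n : ℝ) + -1 / n) / 2) ^ 2 = 1 / (n : ℝ) ^ 2 by ring,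
    abs_of_nonneg (show (0 : ℝ) ≤ 1 / (n : ℝ) ^ 2 by positivity)]
  exact mul_le_of_le_one_left (by positivity)
    (Finset.prod_le_one (fun _ _ => abs_nonneg _) hb)

lemma sq_bounds {n m : ℕ} (hm : n = 2 * m + 1) (hn7 : 7 ≤ n) {σ : ℝ}
    (hσ2 : σ ^ 2 = ((n : ℝ) / 4) * (1 - lamBarFull n 2 m)
        + ((n : ℝ) ^ 2 / 4) * lamBarFull n 2 m) :
    (n : ℝ) - 1 ≤ 4 * σ ^ 2 ∧ 4 * σ ^ 2 ≤ n + 1 := by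
  have hN : (7 : ℝ) ≤ n := by exact_mod_cast hn7
  have h := abs_lamBarFull_le hm hn7
  rw [le_div_iff₀ (by positivity), ← abs_of_pos (show (0 : ℝ) < (n : ℝ) ^ 2 by positivity),
    ← abs_mul] at h
  have h2 : |lamBarFull n 2 m * ((n : ℝ) ^ 2 - n)| ≤ 1 := by
    refine le_trans ?_ h
    rw [abs_mul, abs_mul]
    refine mul_le_mul_of_nonneg_left ?_ (abs_nonneg _)
    rw [abs_of_nonneg (by nlinarith), abs_of_nonneg (by positivity)]
    linarith
  obtain ⟨h3, h4⟩ := abs_le.1 h2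
  constructor <;> nlinarith

end Variance

section BerryEsseen

lemma stein_error_le {N s : ℝ} (hN : 289 ≤ N) (hs : 0 < s) (h1 : N - 1 ≤ 4 * s ^ 2)
    (h2 : 4 * s ^ 2 ≤ N + 1) {x : ℝ}
    (hx : N / (4 * s ^ 2) * x ≤ |N / (4 * s ^ 2) - 1| * (1 + N / (4 * s ^ 2)) +
      N / (4 * s ^ 2) * (5 / 2 + N / (4 * s ^ 2) / 2) / s) :
    x + (N + 1) / N ^ 2 ≤ 4 / s := by
  have hq : 0 < 4 * s ^ 2 := by positivity
  have hN0 : 0 < N := by linarith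
  have hs8 : 8 ≤ s := by nlinarith
  have hv : N / (4 * s ^ 2) ≤ 1.004 := by
    rw [div_le_iff₀ hq]
    linarith
  have hd : |N / (4 * s ^ 2) - 1| = N / (4 * s ^ 2) * (|N - 4 * s ^ 2| / N) := by
    rw [div_sub_one hq.ne', abs_div, abs_of_pos hq]
    field_simp
  have hv0 : 0 < N / (4 * s ^ 2) := by positivity
  rw [hd] at hx
  generalize N / (4 * s ^ 2) = v at *
  have hx2 : x ≤ |N - 4 * s ^ 2| / N * (1 + v) + (5 / 2 + v / 2) / s := by
    refine le_of_mul_le_mul_left (hx.trans_eq ?_) hv0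
    ring
  have h3 : |N - 4 * s ^ 2| ≤ 1 := abs_le.2 ⟨by linarith, by linarith⟩
  have h4 : |N - 4 * s ^ 2| / N * (1 + v) ≤ 1 / N * 2.004 := by
    gcongr
    linarith
  have h5 : (5 / 2 + v / 2) / s ≤ 3.002 / s := by
    gcongr
    linarith
  have h6 : (N + 1) / N ^ 2 ≤ 1 / N * 1.01 := by
    rw [div_le_iff₀ (by positivity)]
    field_simp
    linarith
  have h7 : 1 / N ≤ 1 / s * (1 / 5) := by
    rw [div_mul_div_comm, div_le_div_iff₀ hN0 (by positivity)]
    nlinarith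
  have h8 : 4 / s = 1 / s * 4 := by ring
  have h9 : 3.002 / s = 1 / s * 3.002 := by ring
  have h10 : 0 < 1 / s := by positivity
  rw [h8]
  rw [h9] at h5
  linarith

lemma abs_terminalProb_sub_stdCDF_le {n m : ℕ} (hm : n = 2 * m + 1) (hm144 : 144 ≤ m) {s : ℝ}
    (hs : 0 < s) (h1 : (n : ℝ) - 1 ≤ 4 * s ^ 2) (h2 : 4 * s ^ 2 ≤ n + 1) (z : ℝ) :
    |terminalProb n (Finset.univ.filter fun y => stdWeight s y ≤ z) - stdCDF z| ≤
      4 / s + 2 / s * (1 / Real.sqrt (2 * Real.pi)) := by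
  have hn : 0 < n := by omega
  have hN : (289 : ℝ) ≤ n := by exact_mod_cast (show 289 ≤ n by omega)
  have hε : |processEigen n Finset.univ| ≤ 1 := by
    rcases processEigen_univ n with h | h <;> simp [h]
  have hF : (∑ S : Finset (Fin n), if S = ∅ ∨ S = Finset.univ then 0 else |processEigen n S|) ≤
      ((n : ℝ) + 1) / (n : ℝ) ^ 2 := by
    subst hm
    exact sum_abs_processEigen_le hm144
  obtain ⟨h3, h4⟩ := abs_le.1 ((abs_terminalProb_sub_le hn
    (Finset.univ.filter fun y => stdWeight s y ≤ z)).trans hF)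
  have h5 := sum_parity_le hn hε hs z
  have h6 := le_sum_parity hn hε hs z
  have h7 := stein_error_le hN hs h1 h2 (cubeCDF_le_stdCDF (n := n) hs (z + 2 / s))
  have h8 := stein_error_le hN hs h1 h2 (stdCDF_le_cubeCDF (n := n) hs (z - 2 / s))
  have h9 := stdCDF_add_le z (show 0 ≤ 2 / s by positivity)
  have h10 := stdCDF_add_le (z - 2 / s) (show 0 ≤ 2 / s by positivity)
  rw [show z + 2 / s - 1 / s = z + 1 / s by ring] at h7
  rw [show z - 2 / s + 1 / s = z - 1 / s by ring] at h8
  rw [sub_add_cancel] at h10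
  rw [abs_le]
  constructor <;> linarith

lemma terminalProb_nonneg (n : ℕ) (B : Finset (Fin n → Bool)) : 0 ≤ terminalProb n B := by
  rw [terminalProb]
  positivity

lemma terminalProb_le_one (n : ℕ) (B : Finset (Fin n → Bool)) : terminalProb n B ≤ 1 := by
  rw [terminalProb, div_le_one (card_validArrays_pos n)]
  exact_mod_cast Finset.card_filter_le _ _

lemma toReal_measure_bulbOn_mem {n : ℕ} {Ω : Type*} [MeasurableSpace Ω] (P : Measure Ω)
    {A : Ω → (Fin n → Fin n → Bool)} (hA : Measurable A)
    (hdist : ∀ e, P {ω | A ω = e} =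
      if e ∈ validArrays n n (stdPattern n)
      then ((validArrays n n (stdPattern n)).card : ENNReal)⁻¹ else 0)
    (B : Finset (Fin n → Bool)) :
    (P {ω | bulbOn (A ω) ∈ B}).toReal = terminalProb n B := by
  have h : {ω | bulbOn (A ω) ∈ B} =
      ⋃ e ∈ Finset.univ.filter (fun e : Fin n → Fin n → Bool => bulbOn e ∈ B),
        {ω | A ω = e} := by
    ext ω
    simp
  rw [h, measure_biUnion_finset]
  · rw [Finset.sum_congr rfl fun e _ => hdist e, ← Finset.sum_filter, Finset.sum_const,
      nsmul_eq_mul, terminalProb, ENNReal.toReal_mul, ENNReal.toReal_inv, ENNReal.toReal_natCast,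
      ENNReal.toReal_natCast, div_eq_mul_inv, Finset.filter_filter]
    congr 3
    ext e
    simp [and_comm]
  · exact fun e _ e' _ hne => Set.disjoint_left.2 fun ω h1 h2 => hne (h1.symm.trans h2)
  · exact fun e _ => hA (measurableSet_singleton e)

end BerryEsseen

/-- Berry–Esseen bound for the lightbulb process, odd case. -/
theorem lightbulb_berry_esseen_odd {n m : ℕ} (hm : n = 2 * m + 1) (hn7 : 7 ≤ n)
    {Ω : Type} [MeasurableSpace Ω] (P : Measure Ω) [IsProbabilityMeasure P]
    (A : Ω → (Fin n → Fin n → Bool)) (hA : Measurable A)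
    (hdist : ∀ e, P {ω | A ω = e} =
      if e ∈ validArrays n n (stdPattern n)
      then ((validArrays n n (stdPattern n)).card : ENNReal)⁻¹ else 0)
    (σV : ℝ) (hσ0 : 0 ≤ σV)
    (hσ2 : σV ^ 2 = ((n : ℝ) / 4) * (1 - lamBarFull n 2 m)
        + ((n : ℝ) ^ 2 / 4) * lamBarFull n 2 m) :
    ∀ z : ℝ,
      |(P {ω | ((numOn (A ω) : ℝ) - n / 2) / σV ≤ z}).toReal
          - ((gaussianReal 0 1) (Set.Iic z)).toReal|
        ≤ (n : ℝ) / (2 * σV ^ 2) *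
              (1 / Real.sqrt n + (1 / (2 * Real.sqrt 2)) * Real.exp (-(n : ℝ) / 4))
          + 1.64 * (n : ℝ) / σV ^ 3
          + (2 / σV) * (1 + 1 / Real.sqrt (2 * Real.pi)) := by
  intro z
  obtain ⟨h1, h2⟩ := sq_bounds hm hn7 hσ2
  have hN : (7 : ℝ) ≤ n := by exact_mod_cast hn7
  have hσ : 0 < σV := hσ0.lt_of_ne fun h => by
    rw [← h] at h1
    linarith
  have hP : (P {ω | ((numOn (A ω) : ℝ) - n / 2) / σV ≤ z}).toReal =
      terminalProb n (Finset.univ.filter fun y => stdWeight σV y ≤ z) := by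
    rw [← toReal_measure_bulbOn_mem P hA hdist]
    simp only [Finset.mem_filter_univ]
    rfl
  change |_ - stdCDF z| ≤ _
  rw [hP]
  have hfirst : 0 ≤ (n : ℝ) / (2 * σV ^ 2) *
      (1 / Real.sqrt n + (1 / (2 * Real.sqrt 2)) * Real.exp (-(n : ℝ) / 4)) := by positivity
  have hsecond : 5.74 / σV ≤ 1.64 * (n : ℝ) / σV ^ 3 := by
    rw [div_le_div_iff₀ hσ (by positivity)]
    nlinarith
  have hthird : 2 / σV * (1 + 1 / Real.sqrt (2 * Real.pi)) =
      2 / σV + 2 / σV * (1 / Real.sqrt (2 * Real.pi)) := by ring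
  rw [hthird]
  have hsplit : 5.74 / σV + 2 / σV = 7.74 / σV := by ring
  rcases le_or_gt σV 8.5 with hle | hgt
  · have hpi : 0.39 ≤ 1 / Real.sqrt (2 * Real.pi) := by
      rw [le_div_iff₀ (by positivity)]
      have : Real.sqrt (2 * Real.pi) ≤ 2.51 := by
        rw [Real.sqrt_le_left (by norm_num)]
        linarith [Real.pi_lt_d2]
      linarith
    have hone : 1 ≤ 7.74 / σV + 2 / σV * 0.39 := by
      rw [show 7.74 / σV + 2 / σV * 0.39 = 8.52 / σV by ring, le_div_iff₀ hσ]
      linarith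
    have hmul : 2 / σV * 0.39 ≤ 2 / σV * (1 / Real.sqrt (2 * Real.pi)) :=
      mul_le_mul_of_nonneg_left hpi (by positivity)
    have hB := terminalProb_nonneg n (Finset.univ.filter fun y => stdWeight σV y ≤ z)
    have hB' := terminalProb_le_one n (Finset.univ.filter fun y => stdWeight σV y ≤ z)
    rw [abs_le]
    constructor <;> linarith [stdCDF_nonneg z, stdCDF_le_one z]
  · have hn : 288 < n := by
      have : (288 : ℝ) < n := by nlinarith
      exact_mod_cast this
    have h := abs_terminalProb_sub_stdCDF_le hm (by omega) hσ h1 h2 z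
    have h4 : 4 / σV ≤ 7.74 / σV := by
      gcongr
      norm_num
    linarith
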